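/- arXiv:2511.01116 — 2 statements merged into one kernel-verified Lean document; each statement's English description precedes it below -/
import Mathlib

section
/- Define h : ℝ → ℝ by h(y) = (1/Q(y))·∫_y^∞ z·Q(z)² dz. Then h(y) > 0 for every y ∈ ℝ, and there exists a constant C > 0 such that h(y) ≤ C·(1+|y|)·Q(y) for every y ∈ ℝ. -/
open MeasureTheory Real

/-- The soliton `Q(y) = √2 / cosh y`. -/
noncomputable def Q (y : ℝ) : ℝ := Real.sqrt 2 / Real.cosh y

/-- The auxiliary function `h(y) = (1/Q(y)) ∫_y^∞ z Q(z)² dz`. -/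
noncomputable def h (y : ℝ) : ℝ := (1 / Q y) * ∫ z in Set.Ioi y, z * (Q z) ^ 2

lemma Q_pos (y : ℝ) : 0 < Q y := div_pos (by positivity) (cosh_pos y)

lemma Q_sq (y : ℝ) : Q y ^ 2 = 2 / cosh y ^ 2 := by
  rw [Q, div_pow, sq_sqrt zero_le_two]

lemma continuous_Q : Continuous Q :=
  continuous_const.div continuous_cosh fun y => (cosh_pos y).ne'

/-- Half of the tail integral `∫_y^∞ z Q(z)² dz`, in closed form. -/
noncomputable def halfTail (y : ℝ) : ℝ := log (2 * cosh y) - y * (sinh y / cosh y)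

lemma halfTail_neg (y : ℝ) : halfTail (-y) = halfTail y := by
  simp [halfTail, neg_div]

lemma halfTail_abs (y : ℝ) : halfTail |y| = halfTail y := by
  rcases abs_choice y with hy | hy <;> simp [hy, halfTail_neg]

lemma hasDerivAt_halfTail (y : ℝ) : HasDerivAt halfTail (-(y / cosh y ^ 2)) y := by
  have hc := (cosh_pos y).ne'
  have hlog := ((hasDerivAt_cosh y).const_mul 2).log (by positivity)
  have htanh := (hasDerivAt_id y).mul ((hasDerivAt_sinh y).div (hasDerivAt_cosh y) hc)
  refine (hlog.sub htanh).congr_deriv ?_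
  simp only [id, Pi.div_apply]
  field_simp
  linear_combination (-y) * cosh_sq y

lemma log_two_mul_cosh (y : ℝ) : log (2 * cosh y) = y + log (1 + exp (-(2 * y))) := by
  have hexp : 2 * cosh y = exp y * (1 + exp (-(2 * y))) := by
    rw [mul_add, ← exp_add, cosh_eq]
    ring_nf
  rw [hexp, log_mul (exp_pos y).ne' (by positivity), log_exp]

lemma halfTail_pos (y : ℝ) : 0 < halfTail y := by
  rw [← halfTail_abs, halfTail, log_two_mul_cosh]
  have hlog : 0 < log (1 + exp (-(2 * |y|))) := log_pos (by linarith [exp_pos (-(2 * |y|))])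
  have htanh := (tanh_lt_one |y|).le
  rw [tanh_eq_sinh_div_cosh] at htanh
  nlinarith [mul_le_mul_of_nonneg_left htanh (abs_nonneg y)]

lemma halfTail_le (y : ℝ) : halfTail y ≤ (1 + 2 * |y|) * exp (-(2 * |y|)) := by
  rw [← halfTail_abs, halfTail, log_two_mul_cosh]
  have hlog := log_le_sub_one_of_pos (show 0 < 1 + exp (-(2 * |y|)) by positivity)
  have htanh : 1 - 2 * exp (-(2 * |y|)) ≤ sinh |y| / cosh |y| := by
    rw [le_div_iff₀ (cosh_pos _)]
    have hexp : exp (-(2 * |y|)) * exp |y| = exp (-|y|) := by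
      rw [← exp_add]
      ring_nf
    have hcosh : exp |y| ≤ 2 * cosh |y| := by
      rw [cosh_eq]
      linarith [exp_pos (-|y|)]
    linarith [cosh_sub_sinh |y|, mul_le_mul_of_nonneg_left hcosh (exp_pos (-(2 * |y|))).le]
  nlinarith [mul_le_mul_of_nonneg_left htanh (abs_nonneg y)]

lemma two_mul_exp_le_Q_sq (y : ℝ) : 2 * exp (-(2 * |y|)) ≤ Q y ^ 2 := by
  have hcosh : cosh y ≤ exp |y| := by
    rw [← cosh_abs, cosh_eq]
    linarith [exp_le_exp.2 (show -|y| ≤ |y| by linarith [abs_nonneg y])]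
  have hsq : cosh y ^ 2 ≤ exp (2 * |y|) := by
    calc cosh y ^ 2 ≤ exp |y| ^ 2 := pow_le_pow_left₀ (cosh_pos y).le hcosh 2
      _ = exp (2 * |y|) := by rw [← exp_nat_mul, Nat.cast_ofNat]
  rw [Q_sq, exp_neg, ← div_eq_mul_inv]
  exact div_le_div_of_nonneg_left zero_le_two (pow_pos (cosh_pos y) 2) hsq

lemma tendsto_halfTail_atTop : Filter.Tendsto halfTail Filter.atTop (nhds 0) := by
  have hbound : Filter.Tendsto (fun y : ℝ => (1 + 2 * y) * exp (-(2 * y)))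
      Filter.atTop (nhds 0) := by
    have hexp := tendsto_pow_mul_exp_neg_atTop_nhds_zero 0
    have hmul := tendsto_pow_mul_exp_neg_atTop_nhds_zero 1
    have hsum := (hexp.add hmul).comp
      (Filter.tendsto_id.const_mul_atTop (zero_lt_two (α := ℝ)))
    rw [add_zero] at hsum
    refine hsum.congr fun y => ?_
    simp only [Function.comp_apply, id]
    ring
  refine tendsto_of_tendsto_of_tendsto_of_le_of_le' tendsto_const_nhds hbound
    (.of_forall fun y => (halfTail_pos y).le) ?_
  filter_upwards [Filter.eventually_ge_atTop 0] with y hy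
  simpa [abs_of_nonneg hy] using halfTail_le y

lemma hasDerivAt_neg_two_mul_halfTail (y : ℝ) :
    HasDerivAt (fun z => -2 * halfTail z) (y * Q y ^ 2) y := by
  refine ((hasDerivAt_halfTail y).const_mul (-2)).congr_deriv ?_
  rw [Q_sq]
  ring

lemma tendsto_neg_two_mul_halfTail_atTop :
    Filter.Tendsto (fun z => -2 * halfTail z) Filter.atTop (nhds 0) := by
  simpa using tendsto_halfTail_atTop.const_mul (-2)

lemma integrableOn_mul_Q_sq (y : ℝ) : IntegrableOn (fun z => z * Q z ^ 2) (Set.Ioi y) := by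
  have hpos : IntegrableOn (fun z => z * Q z ^ 2) (Set.Ioi 0) :=
    integrableOn_Ioi_deriv_of_nonneg' (fun z _ => hasDerivAt_neg_two_mul_halfTail z)
      (fun z hz => mul_nonneg (le_of_lt hz) (sq_nonneg _)) tendsto_neg_two_mul_halfTail_atTop
  have hcompact : IntegrableOn (fun z => z * Q z ^ 2) (Set.Icc y 0) :=
    (continuous_id.mul (continuous_Q.pow 2)).continuousOn.integrableOn_Icc
  refine (hcompact.union hpos).mono_set fun z hz => ?_
  rcases le_or_gt z 0 with h0 | h0
  · exact Or.inl ⟨le_of_lt hz, h0⟩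
  · exact Or.inr h0

lemma integral_mul_Q_sq (y : ℝ) : ∫ z in Set.Ioi y, z * Q z ^ 2 = 2 * halfTail y := by
  rw [integral_Ioi_of_hasDerivAt_of_tendsto' (fun z _ => hasDerivAt_neg_two_mul_halfTail z)
    (integrableOn_mul_Q_sq y) tendsto_neg_two_mul_halfTail_atTop]
  ring

/-- `h` is positive and bounded by `C (1+|y|) Q(y)`. -/
theorem h_pos_and_decay :
    (∀ y : ℝ, 0 < h y) ∧ ∃ C > (0 : ℝ), ∀ y : ℝ, h y ≤ C * (1 + |y|) * Q y := by
  refine ⟨fun y => ?_, 2, zero_lt_two, fun y => ?_⟩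
  · rw [h, integral_mul_Q_sq]
    exact mul_pos (one_div_pos.2 (Q_pos y)) (mul_pos zero_lt_two (halfTail_pos y))
  · rw [h, integral_mul_Q_sq, one_div_mul_eq_div, div_le_iff₀ (Q_pos y)]
    calc 2 * halfTail y ≤ (1 + 2 * |y|) * (2 * exp (-(2 * |y|))) := by
          linarith [halfTail_le y]
      _ ≤ 2 * (1 + |y|) * Q y ^ 2 :=
          mul_le_mul (by linarith) (two_mul_exp_le_Q_sq y) (by positivity) (by positivity)
      _ = 2 * (1 + |y|) * Q y * Q y := by ring
end

section
/- (Factorisation identity.) For every smooth function f : ℝ → ℝ, one has S²(L₊(L₋ f)) = M²(S²f) pointwise on ℝ, where S is the first-order operator Sg = g' - (Q'/Q)·g, L₊g = -g'' + g - 3Q²·g, L₋g = -g'' + g - Q²·g, and Mg = -g'' + g. -/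
open MeasureTheory Real

/-- The operator `L₊ f = -f'' + f - 3Q²f`. -/
noncomputable def Lp (f : ℝ → ℝ) : ℝ → ℝ :=
  fun y => -(deriv (deriv f) y) + f y - 3 * (Q y) ^ 2 * f y

/-- The operator `L₋ f = -f'' + f - Q²f`. -/
noncomputable def Lm (f : ℝ → ℝ) : ℝ → ℝ :=
  fun y => -(deriv (deriv f) y) + f y - (Q y) ^ 2 * f y

/-- The first-order operator `S g = g' - (Q'/Q) g`. -/
noncomputable def Sop (g : ℝ → ℝ) : ℝ → ℝ :=
  fun y => deriv g y - (deriv Q y / Q y) * g y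

/-- The operator `M g = -g'' + g`. -/
noncomputable def M (g : ℝ → ℝ) : ℝ → ℝ :=
  fun y => -(deriv (deriv g) y) + g y

/-- The formal adjoint `g ↦ -g' + tanh · g` of `Sop`. -/
noncomputable def SopAdjoint (g : ℝ → ℝ) : ℝ → ℝ :=
  fun y => -deriv g y + Real.tanh y * g y

lemma hasDerivAt_tanh (y : ℝ) : HasDerivAt Real.tanh (1 - Real.tanh y ^ 2) y := by
  have hc := (Real.cosh_pos y).ne'
  have h := (Real.hasDerivAt_sinh y).div (Real.hasDerivAt_cosh y) hc
  have he : Real.tanh = Real.sinh / Real.cosh := by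
    funext x
    exact Real.tanh_eq_sinh_div_cosh x
  rw [Real.tanh_eq_sinh_div_cosh, he]
  refine h.congr_deriv ?_
  field_simp

@[fun_prop]
lemma differentiable_tanh : Differentiable ℝ Real.tanh :=
  fun y => (hasDerivAt_tanh y).differentiableAt

lemma deriv_tanh (y : ℝ) : deriv Real.tanh y = 1 - Real.tanh y ^ 2 :=
  (hasDerivAt_tanh y).deriv

lemma contDiff_tanh {n : WithTop ℕ∞} : ContDiff ℝ n Real.tanh := by
  have he : Real.tanh = fun x => Real.sinh x / Real.cosh x := by
    funext x
    exact Real.tanh_eq_sinh_div_cosh x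
  rw [he]
  exact Real.contDiff_sinh.div Real.contDiff_cosh fun x => (Real.cosh_pos x).ne'

lemma Q_sq_s14 (y : ℝ) : Q y ^ 2 = 2 * (1 - Real.tanh y ^ 2) := by
  have hc := (Real.cosh_pos y).ne'
  rw [Q, div_pow, Real.sq_sqrt (by norm_num), Real.tanh_eq_sinh_div_cosh]
  field_simp
  rw [Real.cosh_sq]
  ring

lemma deriv_Q_div_Q (y : ℝ) : deriv Q y / Q y = -Real.tanh y := by
  have hc := (Real.cosh_pos y).ne'
  have hs : Real.sqrt 2 ≠ 0 := by positivity
  have h : HasDerivAt Q _ y :=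
    (hasDerivAt_const y (Real.sqrt 2)).div (Real.hasDerivAt_cosh y) hc
  rw [h.deriv, Q, Real.tanh_eq_sinh_div_cosh]
  field_simp
  ring

lemma Sop_eq (g : ℝ → ℝ) : Sop g = fun y => deriv g y + Real.tanh y * g y := by
  funext y
  rw [Sop, deriv_Q_div_Q]
  ring

lemma Lp_eq (g : ℝ → ℝ) :
    Lp g = fun y => -deriv (deriv g) y + (6 * Real.tanh y ^ 2 - 5) * g y := by
  funext y
  rw [_root_.Lp, Q_sq_s14]
  ring

lemma Lm_eq (g : ℝ → ℝ) :
    Lm g = fun y => -deriv (deriv g) y + (2 * Real.tanh y ^ 2 - 1) * g y := by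
  funext y
  rw [Lm, Q_sq_s14]
  ring

lemma contDiff_deriv {g : ℝ → ℝ} (hg : ContDiff ℝ (⊤ : ℕ∞) g) :
    ContDiff ℝ (⊤ : ℕ∞) (deriv g) :=
  (contDiff_infty_iff_deriv.1 hg).2

lemma contDiff_Sop {g : ℝ → ℝ} (hg : ContDiff ℝ (⊤ : ℕ∞) g) :
    ContDiff ℝ (⊤ : ℕ∞) (Sop g) := by
  rw [Sop_eq]
  exact (contDiff_deriv hg).add (contDiff_tanh.mul hg)

lemma contDiff_Lm {g : ℝ → ℝ} (hg : ContDiff ℝ (⊤ : ℕ∞) g) :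
    ContDiff ℝ (⊤ : ℕ∞) (Lm g) := by
  rw [Lm_eq]
  exact (contDiff_deriv (contDiff_deriv hg)).neg.add
    (((contDiff_const.mul (contDiff_tanh.pow 2)).sub contDiff_const).mul hg)

/-- `L₋ = S* S`. -/
lemma Lm_eq_SopAdjoint_Sop {g : ℝ → ℝ} (hg : ContDiff ℝ (⊤ : ℕ∞) g) :
    Lm g = SopAdjoint (Sop g) := by
  have d0 : Differentiable ℝ g := hg.differentiable (by simp)
  have d1 : Differentiable ℝ (deriv g) := (contDiff_deriv hg).differentiable (by simp)
  rw [Sop_eq, Lm_eq]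
  funext y
  simp (disch := fun_prop) only [SopAdjoint, deriv_fun_add, deriv_fun_mul, deriv_tanh]
  ring

/-- `S L₋ = M S`. -/
lemma Sop_Lm {g : ℝ → ℝ} (hg : ContDiff ℝ (⊤ : ℕ∞) g) : Sop (Lm g) = M (Sop g) := by
  have d0 : Differentiable ℝ g := hg.differentiable (by simp)
  have h1 := contDiff_deriv hg
  have d1 : Differentiable ℝ (deriv g) := h1.differentiable (by simp)
  have d2 : Differentiable ℝ (deriv (deriv g)) :=
    (contDiff_deriv h1).differentiable (by simp)
  have e : deriv (Sop g) = fun y =>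
      deriv (deriv g) y + ((1 - Real.tanh y ^ 2) * g y + Real.tanh y * deriv g y) := by
    funext y
    rw [Sop_eq]
    simp (disch := fun_prop) only [deriv_fun_add, deriv_fun_mul, deriv_tanh]
  funext y
  rw [M, e, Sop_eq, Sop_eq, Lm_eq]
  simp (disch := fun_prop) only [deriv_fun_add, deriv_fun_sub, deriv_fun_mul, deriv_fun_pow,
    deriv.fun_neg, deriv_const, deriv_tanh]
  norm_num
  ring

/-- `S L₊ S* = L₋²`. -/
lemma Sop_Lp_SopAdjoint {g : ℝ → ℝ} (hg : ContDiff ℝ (⊤ : ℕ∞) g) :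
    Sop (Lp (SopAdjoint g)) = Lm (Lm g) := by
  have d0 : Differentiable ℝ g := hg.differentiable (by simp)
  have h1 := contDiff_deriv hg
  have d1 : Differentiable ℝ (deriv g) := h1.differentiable (by simp)
  have h2 := contDiff_deriv h1
  have d2 : Differentiable ℝ (deriv (deriv g)) := h2.differentiable (by simp)
  have h3 := contDiff_deriv h2
  have d3 : Differentiable ℝ (deriv (deriv (deriv g))) := h3.differentiable (by simp)
  have e1 : deriv (SopAdjoint g) = fun y =>
      -deriv (deriv g) y + ((1 - Real.tanh y ^ 2) * g y + Real.tanh y * deriv g y) := by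
    funext y
    unfold SopAdjoint
    simp (disch := fun_prop) only [deriv_fun_add, deriv_fun_mul, deriv.fun_neg, deriv_tanh]
  have e2 : deriv (deriv (SopAdjoint g)) = fun y =>
      -deriv (deriv (deriv g)) y + 2 * (1 - Real.tanh y ^ 2) * deriv g y
        - 2 * Real.tanh y * (1 - Real.tanh y ^ 2) * g y
        + Real.tanh y * deriv (deriv g) y := by
    funext y
    rw [e1]
    simp (disch := fun_prop) only [deriv_fun_add, deriv_fun_sub, deriv_fun_mul, deriv_fun_pow,
      deriv.fun_neg, deriv_const, deriv_tanh]
    norm_num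
    ring
  have e3 : deriv (Lm g) = fun y => -deriv (deriv (deriv g)) y
      + (4 * Real.tanh y * (1 - Real.tanh y ^ 2) * g y
        + (2 * Real.tanh y ^ 2 - 1) * deriv g y) := by
    funext y
    rw [Lm_eq]
    simp (disch := fun_prop) only [deriv_fun_add, deriv_fun_sub, deriv_fun_mul, deriv_fun_pow,
      deriv.fun_neg, deriv_const, deriv_tanh]
    simp only [Nat.add_one_sub_one, pow_one, Nat.cast_ofNat]
    ring
  funext y
  rw [Sop_eq, Lp_eq, e2, Lm_eq (Lm g), e3, Lm_eq g]
  unfold SopAdjoint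
  simp (disch := fun_prop) only [deriv_fun_add, deriv_fun_sub, deriv_fun_mul, deriv_fun_pow,
    deriv.fun_neg, deriv_const, deriv_tanh]
  norm_num
  ring

/-- The factorisation identity `S² L₊ L₋ = M² S²`. -/
theorem factorisation (f : ℝ → ℝ) (hf : ContDiff ℝ (⊤ : ℕ∞) f) :
    ∀ y : ℝ, Sop (Sop (Lp (Lm f))) y = M (M (Sop (Sop f))) y := by
  intro y
  rw [Lm_eq_SopAdjoint_Sop hf, Sop_Lp_SopAdjoint (contDiff_Sop hf),
    Sop_Lm (contDiff_Lm (contDiff_Sop hf)), Sop_Lm (contDiff_Sop hf)]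
end
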